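/- For all reals α > 2 and c > 0, (1/log L) · ∫₀^∞ max(0, 1 − (c/L)·(e^t − 1)^{2/α}) dt tends to α/2 as L → ∞. -/

import Mathlib

open Real Filter MeasureTheory

lemma continuous_truncated_integrand {α : ℝ} (hα : 0 < α) (b : ℝ) :
    Continuous fun t : ℝ => max 0 (1 - b * (Real.exp t - 1) ^ (2 / α)) := by
  have h : Continuous fun t : ℝ => (Real.exp t - 1) ^ (2 / α) :=
    (Real.continuous_exp.sub continuous_const).rpow_const fun _ => Or.inr (by positivity)
  fun_prop

/-- The truncated integrand vanishes beyond `log 2 + (α/2) log (L/c)`. -/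
lemma truncated_integrand_eq_zero {α c L t : ℝ} (hα : 0 < α) (hc : 0 < c) (hL : c ≤ L)
    (ht : Real.log 2 + α / 2 * Real.log (L / c) < t) :
    max 0 (1 - (c / L) * (Real.exp t - 1) ^ (2 / α)) = 0 := by
  have hL0 : 0 < L := hc.trans_le hL
  have hlog : 0 ≤ Real.log (L / c) := Real.log_nonneg ((one_le_div hc).2 hL)
  have hexp : 2 * Real.exp (α / 2 * Real.log (L / c)) ≤ Real.exp t := by
    calc 2 * Real.exp (α / 2 * Real.log (L / c))
        = Real.exp (Real.log 2 + α / 2 * Real.log (L / c)) := by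
          rw [Real.exp_add, Real.exp_log two_pos]
      _ ≤ Real.exp t := Real.exp_le_exp.2 ht.le
  have hone : 1 ≤ Real.exp (α / 2 * Real.log (L / c)) := Real.one_le_exp (by positivity)
  have hpow : L / c ≤ (Real.exp t - 1) ^ (2 / α) := by
    calc L / c = Real.exp (α / 2 * Real.log (L / c)) ^ (2 / α) := by
          rw [← Real.exp_mul, show α / 2 * Real.log (L / c) * (2 / α) = Real.log (L / c) by
            field_simp, Real.exp_log (by positivity)]
      _ ≤ (Real.exp t - 1) ^ (2 / α) :=
          Real.rpow_le_rpow (Real.exp_pos _).le (by linarith) (by positivity)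
  have hmul : 1 ≤ (c / L) * (Real.exp t - 1) ^ (2 / α) := by
    calc 1 = (c / L) * (L / c) := by field_simp
      _ ≤ _ := by gcongr
  exact max_eq_left (by linarith)

lemma integrableOn_truncated_integrand {α c L : ℝ} (hα : 0 < α) (hc : 0 < c) (hL : c ≤ L) :
    IntegrableOn (fun t : ℝ => max 0 (1 - (c / L) * (Real.exp t - 1) ^ (2 / α)))
      (Set.Ioi 0) := by
  have hI : IntegrableOn (fun t : ℝ => max 0 (1 - (c / L) * (Real.exp t - 1) ^ (2 / α)))
      (Set.Ioc 0 (Real.log 2 + α / 2 * Real.log (L / c))) :=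
    (continuous_truncated_integrand hα _).integrableOn_Ioc
  refine hI.of_forall_sdiff_eq_zero measurableSet_Ioi fun t ht => ?_
  exact truncated_integrand_eq_zero hα hc hL (not_le.1 fun h => ht.2 ⟨ht.1, h⟩)

lemma integral_truncated_integrand_le {α c L : ℝ} (hα : 0 < α) (hc : 0 < c) (hL : c ≤ L) :
    ∫ t in Set.Ioi (0:ℝ), max 0 (1 - (c / L) * (Real.exp t - 1) ^ (2 / α)) ≤
      Real.log 2 + α / 2 * Real.log (L / c) := by
  have hL0 : 0 < L := hc.trans_le hL
  have hlog : 0 ≤ Real.log (L / c) := Real.log_nonneg ((one_le_div hc).2 hL)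
  have hT : 0 ≤ Real.log 2 + α / 2 * Real.log (L / c) := by
    have := Real.log_nonneg one_le_two
    positivity
  rw [setIntegral_eq_of_subset_of_forall_sdiff_eq_zero measurableSet_Ioi
    (Set.Ioc_subset_Ioi_self :
      Set.Ioc 0 (Real.log 2 + α / 2 * Real.log (L / c)) ⊆ Set.Ioi 0)
    fun t ht => truncated_integrand_eq_zero hα hc hL (not_le.1 fun h => ht.2 ⟨ht.1, h⟩)]
  calc _ ≤ ∫ _ in Set.Ioc (0:ℝ) (Real.log 2 + α / 2 * Real.log (L / c)), (1:ℝ) := by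
        refine setIntegral_mono_on (continuous_truncated_integrand hα _).integrableOn_Ioc
          continuous_const.integrableOn_Ioc measurableSet_Ioc fun t ht => ?_
        have h : 0 ≤ Real.exp t - 1 := sub_nonneg.2 (Real.one_le_exp ht.1.le)
        have : 0 ≤ (c / L) * (Real.exp t - 1) ^ (2 / α) := by positivity
        exact max_le zero_le_one (by linarith)
    _ = _ := by simp [hT]

lemma le_integral_truncated_integrand {α c L : ℝ} (hα : 0 < α) (hc : 0 < c) (hL : c ≤ L)
    (hL1 : 1 ≤ L) :
    α / 2 * Real.log L - c * (α / 2) ≤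
      ∫ t in Set.Ioi (0:ℝ), max 0 (1 - (c / L) * (Real.exp t - 1) ^ (2 / α)) := by
  have hL0 : 0 < L := hc.trans_le hL
  have hS : 0 ≤ α / 2 * Real.log L := by
    have := Real.log_nonneg hL1
    positivity
  have hexp : ∫ t in (0:ℝ)..(α / 2 * Real.log L), Real.exp (2 / α * t) =
      α / 2 * (L - 1) := by
    rw [intervalIntegral.integral_comp_mul_left (fun t => Real.exp t) (by positivity),
      integral_exp, show 2 / α * (α / 2 * Real.log L) = Real.log L by field_simp,
      Real.exp_log hL0]
    simp
  calc α / 2 * Real.log L - c * (α / 2)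
      ≤ α / 2 * Real.log L - (c / L) * (α / 2 * (L - 1)) := by
        have : (c / L) * (α / 2 * (L - 1)) = c * (α / 2) - c / L * (α / 2) := by
          field_simp
        have : 0 ≤ c / L * (α / 2) := by positivity
        linarith
    _ = ∫ t in (0:ℝ)..(α / 2 * Real.log L), (1 - (c / L) * Real.exp (2 / α * t)) := by
        rw [intervalIntegral.integral_sub (by simp)
          (Continuous.intervalIntegrable (by fun_prop) _ _),
          intervalIntegral.integral_const_mul, hexp]
        simp
    _ = ∫ t in Set.Ioc (0:ℝ) (α / 2 * Real.log L), (1 - (c / L) * Real.exp (2 / α * t)) :=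
        intervalIntegral.integral_of_le hS
    _ ≤ ∫ t in Set.Ioc (0:ℝ) (α / 2 * Real.log L),
          max 0 (1 - (c / L) * (Real.exp t - 1) ^ (2 / α)) := by
        refine setIntegral_mono_on (Continuous.integrableOn_Ioc (by fun_prop))
          (continuous_truncated_integrand hα _).integrableOn_Ioc measurableSet_Ioc
          fun t ht => le_max_of_le_right ?_
        have h : (Real.exp t - 1) ^ (2 / α) ≤ Real.exp (2 / α * t) := by
          rw [mul_comm, Real.exp_mul]
          exact Real.rpow_le_rpow (sub_nonneg.2 (Real.one_le_exp ht.1.le)) (by linarith)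
            (by positivity)
        gcongr
    _ ≤ _ := setIntegral_mono_set (integrableOn_truncated_integrand hα hc hL)
        (Eventually.of_forall fun _ => le_max_left _ _)
        Set.Ioc_subset_Ioi_self.eventuallyLE

/-- For `α > 2` and `c > 0`,
`(1/log L) · ∫₀^∞ max(0, 1 − (c/L)(e^t − 1)^{2/α}) dt → α/2` as `L → ∞`. -/
theorem stmt_9 (α c : ℝ) (hα : 2 < α) (hc : 0 < c) :
    Tendsto (fun L : ℝ =>
        (1 / Real.log L) *
          ∫ t in Set.Ioi (0:ℝ), max 0 (1 - (c / L) * (Real.exp t - 1) ^ (2 / α)))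
      atTop (nhds (α / 2)) := by
  have hα0 : 0 < α := by linarith
  have hlim (K : ℝ) : Tendsto (fun L : ℝ => α / 2 + K / Real.log L) atTop (nhds (α / 2)) := by
    simpa using (Real.tendsto_log_atTop.const_div_atTop K).const_add (α / 2)
  refine tendsto_of_tendsto_of_tendsto_of_le_of_le' (hlim (-(c * (α / 2))))
    (hlim (Real.log 2 - α / 2 * Real.log c)) ?_ ?_
  · filter_upwards [eventually_ge_atTop c, eventually_gt_atTop 1] with L hL hL1
    have hlog : 0 < Real.log L := Real.log_pos hL1
    calc α / 2 + -(c * (α / 2)) / Real.log L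
        = (1 / Real.log L) * (α / 2 * Real.log L - c * (α / 2)) := by field_simp; ring
      _ ≤ _ := by
        gcongr
        exact le_integral_truncated_integrand hα0 hc hL hL1.le
  · filter_upwards [eventually_ge_atTop c, eventually_gt_atTop 1] with L hL hL1
    have hlog : 0 < Real.log L := Real.log_pos hL1
    calc _ ≤ (1 / Real.log L) * (Real.log 2 + α / 2 * Real.log (L / c)) := by
          gcongr
          exact integral_truncated_integrand_le hα0 hc hL
      _ = _ := by
        rw [Real.log_div (by linarith) hc.ne']
        field_simp
        ring
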